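/- Let G be a finite group and let X and X' be G-modules. Suppose that for some r ∈ ℤ there is a natural transformation Φ : Ĥ^0(G, Hom_ℤ(X, −)) ⇒ Ĥ^r(G, Hom_ℤ(X', −)) of functors on G-modules. Then there exists a unique x ∈ Ĥ^r(G, Hom_ℤ(X', X)) such that Φ = (−∪x), where the cup product is induced by composition of homomorphisms. -/

import Mathlib

/-!
This file sets up Tate cohomology of a finite group `G` (with coefficients in objects of
`Rep ℤ G`), realized concretely in each degree `n ∈ ℤ` as
`Ĥ^n(G, M) = Ĥ⁰(G, Hom_ℤ(J n, M))`, where `J n` is the standard `n`-th syzygy of the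
trivial module `ℤ` (the `n`-th tensor power of the augmentation ideal `I_G` for `n ≥ 0`,
and of its `ℤ`-linear dual for `n < 0`), and `Ĥ⁰` denotes invariants modulo norms.
Cup products are induced by the canonical comparison maps `J (i+j) ⟶ J i ⊗ J j`.
-/

open CategoryTheory MonoidalCategory TensorProduct

set_option linter.unusedSectionVars false
set_option maxHeartbeats 1000000

attribute [instance 0] AddCommGroup.toIntModule

namespace Enc

/-- Auxiliary (a proposition only): with it, `LinearMap.module` and the like are found over `ℤ`, and
not `AddCommGroup.toIntModule`. -/
instance intSMulCommClass {M : Type*} [AddCommMonoid M] [i : Module ℤ M] :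
    @SMulCommClass ℤ ℤ M i.toSMul i.toSMul :=
  @smulCommClass_self ℤ M _ i.toMulAction

variable {k : Type} [CommRing k] {G : Type} [Group G] [Fintype G]

/-! ### Degree-zero Tate cohomology: invariants modulo norms -/

section Aux
variable {V V₂ : Type} [AddCommGroup V] [Module k V] [AddCommGroup V₂] [Module k V₂]

/-- The norm map `v ↦ ∑_{g ∈ G} g • v` of a representation. -/
noncomputable def rnorm (ρ : Representation k G V) : V →ₗ[k] V := ∑ g : G, ρ g

lemma rnorm_mem_invariants (ρ : Representation k G V) (v : V) :
    rnorm ρ v ∈ ρ.invariants := by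
  intro g
  show (ρ g) ((∑ h : G, ρ h) v) = _
  simp only [LinearMap.sum_apply, map_sum]
  rw [Fintype.sum_equiv (Equiv.mulLeft g) _ (fun h => ρ h v) (fun h => by
    rw [← Module.End.mul_apply, ← map_mul]; rfl)]
  simp [rnorm]

/-- The norm map, viewed as landing in the invariants. -/
noncomputable def rnormRes (ρ : Representation k G V) : V →ₗ[k] ρ.invariants :=
  (rnorm ρ).codRestrict ρ.invariants (rnorm_mem_invariants ρ)

/-- The image of the norm map, inside the invariants. -/
noncomputable def rnormIm (ρ : Representation k G V) : Submodule k ρ.invariants :=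
  LinearMap.range (rnormRes ρ)

/-- Degree-zero Tate cohomology of a representation: invariants modulo norms. -/
noncomputable def tate0 (ρ : Representation k G V) : Type :=
  ρ.invariants ⧸ rnormIm ρ

noncomputable instance (ρ : Representation k G V) : AddCommGroup (tate0 ρ) :=
  inferInstanceAs (AddCommGroup (ρ.invariants ⧸ rnormIm ρ))

noncomputable instance (ρ : Representation k G V) : Module k (tate0 ρ) :=
  inferInstanceAs (Module k (ρ.invariants ⧸ rnormIm ρ))

/-- The Tate class of an invariant vector. -/
noncomputable def tate0mk {ρ : Representation k G V} (v : V) (hv : v ∈ ρ.invariants) :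
    tate0 ρ := Submodule.Quotient.mk (⟨v, hv⟩ : ρ.invariants)

lemma invariants_comp {ρ : Representation k G V} {σ : Representation k G V₂}
    (f : V →ₗ[k] V₂) (hf : ∀ (g : G) (v : V), f (ρ g v) = σ g (f v)) :
    ∀ x ∈ ρ.invariants, f x ∈ σ.invariants := by
  intro x hx g
  rw [← hf g x, hx g]

/-- Functoriality of degree-zero Tate cohomology along equivariant maps. -/
noncomputable def tate0map {ρ : Representation k G V} {σ : Representation k G V₂}
    (f : V →ₗ[k] V₂) (hf : ∀ (g : G) (v : V), f (ρ g v) = σ g (f v)) :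
    tate0 ρ →ₗ[k] tate0 σ :=
  Submodule.mapQ (rnormIm ρ) (rnormIm σ) (f.restrict (invariants_comp f hf))
    (by
      rintro ⟨x, hx⟩ ⟨y, hy⟩
      refine ⟨f y, ?_⟩
      apply Subtype.ext
      have hy' := congrArg Subtype.val hy
      show rnorm σ (f y) = _
      simp only [LinearMap.restrict_apply]
      have : rnorm σ (f y) = f (rnorm ρ y) := by
        simp only [rnorm, LinearMap.sum_apply, map_sum]
        exact Finset.sum_congr rfl fun g _ => (hf g y).symm
      rw [this]
      exact congrArg f hy')

end Aux

/-- Degree-zero Tate cohomology `Ĥ⁰(G, W) = W^G / N_G W` of an object of `Rep k G`. -/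
noncomputable def H0T (W : Rep k G) : Type := tate0 W.ρ

noncomputable instance (W : Rep k G) : AddCommGroup (H0T W) :=
  inferInstanceAs (AddCommGroup (tate0 W.ρ))

noncomputable instance (W : Rep k G) : Module k (H0T W) :=
  inferInstanceAs (Module k (tate0 W.ρ))

/-- Functoriality of `Ĥ⁰` along morphisms of representations. -/
noncomputable def H0Tmap {W W' : Rep k G} (ψ : W ⟶ W') : H0T W →ₗ[k] H0T W' :=
  tate0map ψ.hom (fun g v => Rep.hom_comm_apply ψ g v)

/-! ### The augmentation ideal and the syzygy modules `J n` -/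

/-- The representation of `G` on `H →₀ k` induced by an action of `G` on `H` (what
`Representation.ofMulAction` was when it was a representation on `H →₀ k`). -/
noncomputable def ofMulAction (k G H : Type*) [CommSemiring k] [Monoid G] [MulAction G H] :
    Representation k G (H →₀ k) where
  toFun g := Finsupp.lmapDomain k k (g • ·)
  map_one' := by
    ext x y
    simp
  map_mul' x y := by
    ext z w
    simp [mul_smul]

variable (G)

/-- The augmentation map `ℤ[G] → ℤ`. -/
noncomputable def aug : (G →₀ ℤ) →ₗ[ℤ] ℤ :=
  Finsupp.linearCombination ℤ (fun _ : G => (1 : ℤ))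

lemma aug_comm (g : G) (x : G →₀ ℤ) :
    aug G (ofMulAction ℤ G G g x) = aug G x := by
  unfold aug
  simp [ofMulAction, Finsupp.linearCombination_apply]
  rw [Finsupp.sum_mapDomain_index] <;> simp

/-- The underlying `ℤ`-module of the augmentation ideal. -/
noncomputable abbrev IGcar : Type := LinearMap.ker (aug G)

/-- The representation of `G` on the augmentation ideal. -/
noncomputable def IGρ : Representation ℤ G (IGcar G) where
  toFun g := (ofMulAction ℤ G G g).restrict (p := LinearMap.ker (aug G))
    (q := LinearMap.ker (aug G)) (by
      intro x hx
      simp only [LinearMap.mem_ker] at hx ⊢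
      rw [aug_comm]; exact hx)
  map_one' := by ext x; simp [LinearMap.restrict_apply]
  map_mul' g h := by ext x; simp [LinearMap.restrict_apply, Module.End.mul_apply]

/-- The augmentation ideal `I_G` of `ℤ[G]`, as an object of `Rep ℤ G`. -/
noncomputable def IGrep : Rep ℤ G := Rep.of (IGρ G)

/-- `Hom_ℤ(X, A)` with the conjugation `G`-action, i.e. the internal hom in `Rep ℤ G`. -/
noncomputable abbrev hRep {G : Type} [Group G] (X A : Rep.{0} ℤ G) : Rep.{0} ℤ G :=
  (Rep.ihom X).obj A

/-- The `ℤ`-linear dual of the augmentation ideal, as an object of `Rep ℤ G`. -/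
noncomputable def DIG : Rep ℤ G := hRep (IGrep G) (𝟙_ (Rep ℤ G))

instance : Module.Finite ℤ (IGcar G) := by
  have : Module.Finite ℤ (G →₀ ℤ) :=
    Module.Finite.equiv (Finsupp.linearEquivFunOnFinite ℤ ℤ G).symm
  exact Module.Finite.of_injective (LinearMap.ker (aug G)).subtype Subtype.val_injective

instance : Module.Free ℤ (IGcar G) := by infer_instance

/-- Nonnegative tensor powers `I_G^{⊗ n}` (with `I_G^{⊗ 0} = ℤ`). -/
noncomputable def Jp : ℕ → Rep ℤ G
  | 0 => 𝟙_ (Rep ℤ G)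
  | n + 1 => Jp n ⊗ IGrep G

/-- Tensor powers of the dual of the augmentation ideal. -/
noncomputable def Jn : ℕ → Rep ℤ G
  | 0 => 𝟙_ (Rep ℤ G)
  | n + 1 => Jn n ⊗ DIG G

/-- The standard syzygy modules of the trivial representation `ℤ`, indexed by `ℤ`:
`J n = I_G^{⊗ n}` for `n ≥ 0`, and `J n = (I_G^∨)^{⊗ (-n)}` for `n < 0`. -/
noncomputable def J : ℤ → Rep ℤ G
  | .ofNat n => Jp G n
  | .negSucc n => Jn G (n + 1)

lemma J_ofNat (m : ℕ) : J G (m : ℤ) = Jp G m := rfl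

lemma J_neg (m : ℕ) : J G (-(m : ℤ)) = Jn G m := by cases m <;> rfl

/-- The element of `(I_G)^∨ ⊗ I_G` corresponding to the identity map. -/
noncomputable def preElt : Module.Dual ℤ (IGcar G) ⊗[ℤ] IGcar G :=
  (dualTensorHomEquiv ℤ (IGcar G) (IGcar G)).symm LinearMap.id

/-- The canonical element of `I_G ⊗ (I_G)^∨` corresponding to the identity map. -/
noncomputable def coevElt : (IGrep G ⊗ DIG G).V :=
  (TensorProduct.comm ℤ _ _) (preElt G)

lemma conj_dualTensor (g : G) (t : Module.Dual ℤ (IGcar G) ⊗[ℤ] IGcar G) :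
    dualTensorHom ℤ _ _ (TensorProduct.map ((DIG G).ρ g) ((IGrep G).ρ g) t)
      = (IGrep G).ρ g ∘ₗ (dualTensorHom ℤ _ _ t) ∘ₗ (IGrep G).ρ g⁻¹ := by
  have aux : ∀ (V : Type) [AddCommGroup V] [Module ℤ V] (a b : V →ₗ[ℤ] V)
      (c : Module.Dual ℤ V →ₗ[ℤ] Module.Dual ℤ V) (_ : ∀ f w, c f w = f (b w))
      (t : Module.Dual ℤ V ⊗[ℤ] V), dualTensorHom ℤ V V (TensorProduct.map c a t)
        = a ∘ₗ (dualTensorHom ℤ V V t) ∘ₗ b := by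
    intro V _ _ a b c hc t
    induction t with
    | zero => simp
    | tmul f v =>
        ext w
        simp only [TensorProduct.map_tmul, dualTensorHom_apply,
          LinearMap.comp_apply, hc]
        exact (a.map_smul _ _).symm
    | add x y hx hy =>
        simp only [map_add, hx, hy, LinearMap.add_comp, LinearMap.comp_add]
  exact aux (IGcar G) ((IGrep G).ρ g) ((IGrep G).ρ g⁻¹) ((DIG G).ρ g) (fun _ _ => rfl) t

lemma coevElt_invariant (g : G) :
    ((IGrep G ⊗ DIG G).ρ g) (coevElt G) = coevElt G := by
  show TensorProduct.map ((IGrep G).ρ g) ((DIG G).ρ g)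
      ((TensorProduct.comm ℤ _ _) (preElt G)) = _
  refine (TensorProduct.map_comm _ _ _).trans ?_
  show (TensorProduct.comm ℤ _ _) (TensorProduct.map ((DIG G).ρ g) ((IGrep G).ρ g) (preElt G))
      = (TensorProduct.comm ℤ _ _) (preElt G)
  refine congrArg (TensorProduct.comm ℤ _ _) ?_
  apply (dualTensorHomEquiv ℤ (IGcar G) (IGcar G)).injective
  have h2 : dualTensorHom ℤ (IGcar G) (IGcar G) (preElt G) = LinearMap.id :=
    (dualTensorHomEquiv ℤ (IGcar G) (IGcar G)).apply_symm_apply LinearMap.id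
  show dualTensorHom ℤ (IGcar G) (IGcar G)
      (TensorProduct.map ((DIG G).ρ g) ((IGrep G).ρ g) (preElt G))
    = dualTensorHom ℤ (IGcar G) (IGcar G) (preElt G)
  refine (conj_dualTensor G g (preElt G)).trans ?_
  show (IGrep G).ρ g ∘ₗ dualTensorHom ℤ (IGcar G) (IGcar G) (preElt G) ∘ₗ (IGrep G).ρ g⁻¹
      = dualTensorHom ℤ (IGcar G) (IGcar G) (preElt G)
  rw [h2]
  apply LinearMap.ext
  intro v
  exact (IGrep G).ρ.self_inv_apply g v

/-- The coevaluation `ℤ ⟶ I_G ⊗ I_G^∨`. -/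
noncomputable def coev : 𝟙_ (Rep ℤ G) ⟶ IGrep G ⊗ DIG G :=
  Rep.ofHom ⟨LinearMap.toSpanSingleton ℤ _ (coevElt G), by
    intro g
    apply LinearMap.ext
    intro z
    show LinearMap.toSpanSingleton ℤ _ (coevElt G) ((𝟙_ (Rep ℤ G)).ρ g z)
        = ((IGrep G ⊗ DIG G).ρ g) (LinearMap.toSpanSingleton ℤ _ (coevElt G) z)
    have hz : ((𝟙_ (Rep ℤ G)).ρ g z) = z := rfl
    rw [hz]
    show z • coevElt G = ((IGrep G ⊗ DIG G).ρ g) (z • coevElt G)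
    rw [map_smul, coevElt_invariant]⟩


variable {G}

/-- One-step comparison `J (n+1) ⟶ J n ⊗ I_G`. -/
noncomputable def sMap : ∀ n : ℤ, J G (n + 1) ⟶ J G n ⊗ IGrep G
  | .ofNat m => 𝟙 (Jp G m ⊗ IGrep G)
  | .negSucc 0 =>
      coev G ≫ (β_ (IGrep G) (DIG G)).hom ≫ ((λ_ (DIG G)).inv ▷ IGrep G)
  | .negSucc (m+1) =>
      (ρ_ (Jn G (m+1))).inv ≫ (Jn G (m+1) ◁ (coev G ≫ (β_ (IGrep G) (DIG G)).hom))
        ≫ (α_ (Jn G (m+1)) (DIG G) (IGrep G)).inv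

/-- One-step comparison `J (n-1) ⟶ J n ⊗ I_G^∨`. -/
noncomputable def tMap : ∀ n : ℤ, J G (n - 1) ⟶ J G n ⊗ DIG G
  | .ofNat 0 => 𝟙 (𝟙_ (Rep ℤ G) ⊗ DIG G)
  | .ofNat (m+1) =>
      eqToHom (congrArg (J G) (show (Int.ofNat (m+1)) - 1 = ((m:ℕ) : ℤ) by
        rw [Int.ofNat_eq_coe]; push_cast; ring)) ≫
      (ρ_ (Jp G m)).inv ≫ (Jp G m ◁ coev G) ≫ (α_ (Jp G m) (IGrep G) (DIG G)).inv
  | .negSucc m => eqToHom (show J G (Int.negSucc m - 1) = J G (Int.negSucc m) ⊗ DIG G from rfl)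

/-- Comparison maps `J (i + m) ⟶ J i ⊗ J m` for `m ≥ 0`. -/
noncomputable def μpos (i : ℤ) : ∀ m : ℕ, J G (i + m) ⟶ J G i ⊗ J G (m : ℤ)
  | 0 => eqToHom (congrArg (J G) (by omega)) ≫ (ρ_ (J G i)).inv
  | m + 1 =>
      eqToHom (congrArg (J G) (show i + ((m:ℕ)+1:ℕ) = (i + m) + 1 by omega))
        ≫ sMap (i + m) ≫ (μpos i m ▷ IGrep G) ≫ (α_ (J G i) (J G (m:ℤ)) (IGrep G)).hom

/-- Comparison maps `J (i - m) ⟶ J i ⊗ J (-m)` for `m ≥ 0`. -/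
noncomputable def μneg (i : ℤ) : ∀ m : ℕ, J G (i - m) ⟶ J G i ⊗ J G (-(m : ℤ))
  | 0 => eqToHom (congrArg (J G) (by omega)) ≫ (ρ_ (J G i)).inv
  | m + 1 =>
      eqToHom (congrArg (J G) (show i - ((m:ℕ)+1:ℕ) = (i - m) - 1 by omega))
        ≫ tMap (i - m) ≫ (μneg i m ▷ DIG G) ≫ (α_ (J G i) (J G (-(m:ℤ))) (DIG G)).hom
        ≫ (J G i ◁ (eqToHom (show J G (-(m:ℤ)) ⊗ DIG G = J G (-((m:ℕ)+1:ℕ)) by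
            rw [J_neg, J_neg]; rfl)))

variable (G)

/-- The canonical comparison map `J (i+j) ⟶ J i ⊗ J j`, implementing the standard stable
equivalences between the syzygies `J`; it induces the cup product on Tate cohomology. -/
noncomputable def μ (i : ℤ) : ∀ j : ℤ, J G (i + j) ⟶ J G i ⊗ J G j
  | .ofNat m => μpos i m
  | .negSucc m =>
      eqToHom (congrArg (J G) (show i + Int.negSucc m = i - ((m+1 : ℕ) : ℤ) by
        rw [Int.negSucc_eq]; push_cast; ring))
        ≫ μneg i (m+1)

variable {G}

/-! ### Tate cohomology in all degrees, functoriality, cup products -/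

/-- Tate cohomology `Ĥ^n(G, M)` of the finite group `G` with coefficients in `M : Rep ℤ G`,
realized as `Ĥ⁰(G, Hom_ℤ(J n, M))` for the standard `n`-th syzygy `J n` of `ℤ`. -/
noncomputable def tate (n : ℤ) (M : Rep ℤ G) : Type := H0T (hRep (J G n) M)

noncomputable instance (n : ℤ) (M : Rep ℤ G) : AddCommGroup (tate n M) :=
  inferInstanceAs (AddCommGroup (H0T (hRep (J G n) M)))

/-- The map on Tate cohomology induced by a morphism of representations. -/
noncomputable def tmap (n : ℤ) {M N : Rep ℤ G} (φ : M ⟶ N) : tate n M → tate n N :=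
  H0Tmap ((Rep.ihom (J G n)).map φ)

/-- Transport of Tate cohomology along an equality of degrees. -/
noncomputable def tcast {i j : ℤ} {M : Rep ℤ G} (h : i = j) (z : tate i M) : tate j M :=
  h ▸ z

lemma hom_invariant {X W : Rep.{0} ℤ G} (m : X ⟶ W) :
    m.hom.toLinearMap ∈ (Representation.linHom X.ρ W.ρ).invariants := by
  intro g
  show W.ρ g ∘ₗ m.hom.toLinearMap ∘ₗ X.ρ g⁻¹ = m.hom.toLinearMap
  ext v
  simp only [LinearMap.comp_apply]
  exact (congrArg (W.ρ g) (Rep.hom_comm_apply m g⁻¹ v)).trans (W.ρ.self_inv_apply g _)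

/-- The Tate cohomology class of a `G`-equivariant map `J n ⟶ W`. -/
noncomputable def mkCls {n : ℤ} {W : Rep ℤ G} (m : J G n ⟶ W) : tate n W :=
  tate0mk m.hom.toLinearMap (hom_invariant m)


lemma tensor_rho_eq (M N : Rep ℤ G) (g : G) :
    (M ⊗ N).ρ g = TensorProduct.map (M.ρ g) (N.ρ g) := rfl

lemma cup_invariance {i j : ℤ} {M N : Rep ℤ G}
    (f : ((hRep (J G i) M).ρ.invariants))
    (g : ((hRep (J G j) N).ρ.invariants)) :
    (TensorProduct.map f.1 g.1).comp ((μ G i j).hom.toLinearMap)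
      ∈ (hRep (J G (i + j)) (M ⊗ N)).ρ.invariants := by
  intro gg
  have hf : M.ρ gg ∘ₗ f.1 ∘ₗ (J G i).ρ gg⁻¹ = f.1 := f.2 gg
  have hg : N.ρ gg ∘ₗ g.1 ∘ₗ (J G j).ρ gg⁻¹ = g.1 := g.2 gg
  have hμ : (μ G i j).hom.toLinearMap.comp ((J G (i + j)).ρ gg⁻¹)
      = (TensorProduct.map ((J G i).ρ gg⁻¹) ((J G j).ρ gg⁻¹)).comp (μ G i j).hom.toLinearMap := by
    have h := (μ G i j).hom.isIntertwining' gg⁻¹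
    exact h
  show (M ⊗ N).ρ gg ∘ₗ ((TensorProduct.map f.1 g.1).comp (μ G i j).hom.toLinearMap)
        ∘ₗ (J G (i + j)).ρ gg⁻¹
      = (TensorProduct.map f.1 g.1).comp (μ G i j).hom.toLinearMap
  have aux : ∀ (P Q M' N' R : Type) [AddCommGroup P] [AddCommGroup Q] [AddCommGroup M']
      [AddCommGroup N'] [AddCommGroup R] [Module ℤ P] [Module ℤ Q] [Module ℤ M'] [Module ℤ N']
      [Module ℤ R] (f' : P →ₗ[ℤ] M') (g' : Q →ₗ[ℤ] N') (m : R →ₗ[ℤ] P ⊗[ℤ] Q)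
      (p : P →ₗ[ℤ] P) (q : Q →ₗ[ℤ] Q) (r : R →ₗ[ℤ] R) (a : M' →ₗ[ℤ] M') (b : N' →ₗ[ℤ] N')
      (_ : m ∘ₗ r = TensorProduct.map p q ∘ₗ m),
      TensorProduct.map a b ∘ₗ (TensorProduct.map f' g' ∘ₗ m) ∘ₗ r
        = TensorProduct.map (a ∘ₗ f' ∘ₗ p) (b ∘ₗ g' ∘ₗ q) ∘ₗ m := by
    intro P Q M' N' R _ _ _ _ _ _ _ _ _ _ f' g' m p q r a b h
    rw [LinearMap.comp_assoc, h, TensorProduct.map_comp, TensorProduct.map_comp]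
    rfl
  exact (aux _ _ _ _ _ f.1 g.1 (μ G i j).hom.toLinearMap _ _ _ (M.ρ gg) (N.ρ gg) hμ).trans
    (congrArg₂ (fun x y => (TensorProduct.map x y).comp (μ G i j).hom.toLinearMap) hf hg)

lemma conj_term {i j : ℤ} {M N : Rep ℤ G} (u : (J G i).V →ₗ[ℤ] M.V)
    (w : (J G j).V →ₗ[ℤ] N.V) (h : G) :
    (TensorProduct.map (M.ρ h ∘ₗ u ∘ₗ (J G i).ρ h⁻¹) (N.ρ h ∘ₗ w ∘ₗ (J G j).ρ h⁻¹)).comp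
        (μ G i j).hom.toLinearMap
      = ((hRep (J G (i + j)) (M ⊗ N)).ρ h) ((TensorProduct.map u w).comp (μ G i j).hom.toLinearMap) := by
  have hμ : (μ G i j).hom.toLinearMap ∘ₗ (J G (i + j)).ρ h⁻¹
      = TensorProduct.map ((J G i).ρ h⁻¹) ((J G j).ρ h⁻¹) ∘ₗ (μ G i j).hom.toLinearMap := by
    have hc := (μ G i j).hom.isIntertwining' h⁻¹
    exact hc
  show _ = (M ⊗ N).ρ h ∘ₗ ((TensorProduct.map u w).comp (μ G i j).hom.toLinearMap) ∘ₗ (J G (i + j)).ρ h⁻¹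
  rw [LinearMap.comp_assoc, hμ, ← LinearMap.comp_assoc, ← LinearMap.comp_assoc]
  rw [TensorProduct.map_comp, TensorProduct.map_comp]
  rfl

lemma cup_norm_left {i j : ℤ} {M N : Rep ℤ G} (u : (J G i).V →ₗ[ℤ] M.V)
    (g : ((hRep (J G j) N).ρ.invariants)) :
    (TensorProduct.map (rnorm ((hRep (J G i) M).ρ) u) g.1).comp (μ G i j).hom.toLinearMap
      = rnorm ((hRep (J G (i + j)) (M ⊗ N)).ρ)
          ((TensorProduct.map u g.1).comp (μ G i j).hom.toLinearMap) := by
  have h1 : rnorm ((hRep (J G i) M).ρ) u = ∑ h : G, ((hRep (J G i) M).ρ h) u := by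
    exact LinearMap.sum_apply _ _ _
  have h2 : rnorm ((hRep (J G (i + j)) (M ⊗ N)).ρ) ((TensorProduct.map u g.1).comp (μ G i j).hom.toLinearMap)
      = ∑ h : G, ((hRep (J G (i + j)) (M ⊗ N)).ρ h)
          ((TensorProduct.map u g.1).comp (μ G i j).hom.toLinearMap) := by
    exact LinearMap.sum_apply _ _ _
  rw [h2]
  have aux : ∀ (P Q M' N' R : Type) [AddCommGroup P] [AddCommGroup Q] [AddCommGroup M']
      [AddCommGroup N'] [AddCommGroup R] [Module ℤ P] [Module ℤ Q] [Module ℤ M'] [Module ℤ N']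
      [Module ℤ R] (F : G → P →ₗ[ℤ] M') (g' : Q →ₗ[ℤ] N') (m : R →ₗ[ℤ] P ⊗[ℤ] Q),
      TensorProduct.map (∑ h : G, F h) g' ∘ₗ m = ∑ h : G, TensorProduct.map (F h) g' ∘ₗ m := by
    intro P Q M' N' R _ _ _ _ _ _ _ _ _ _ F g' m
    exact map_sum (AddMonoidHom.mk' (fun u' : P →ₗ[ℤ] M' => TensorProduct.map u' g' ∘ₗ m)
      (by intro x y; rw [TensorProduct.map_add_left, LinearMap.add_comp])) _ _
  refine (congrArg (fun v : (J G i).V →ₗ[ℤ] M.V => (TensorProduct.map v g.1).comp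
    (μ G i j).hom.toLinearMap) h1).trans ?_
  refine (aux _ _ _ _ _ (fun h => ((hRep (J G i) M).ρ h) u) g.1 (μ G i j).hom.toLinearMap).trans ?_
  refine Finset.sum_congr rfl fun h _ => ?_
  have hginv : N.ρ h ∘ₗ g.1 ∘ₗ (J G j).ρ h⁻¹ = g.1 := g.2 h
  refine Eq.trans ?_ (conj_term u g.1 h)
  exact congrArg (fun x => (TensorProduct.map (M.ρ h ∘ₗ u ∘ₗ (J G i).ρ h⁻¹) x).comp
    (μ G i j).hom.toLinearMap) hginv.symm

lemma cup_norm_right {i j : ℤ} {M N : Rep ℤ G}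
    (f : ((hRep (J G i) M).ρ.invariants)) (w : (J G j).V →ₗ[ℤ] N.V) :
    (TensorProduct.map f.1 (rnorm ((hRep (J G j) N).ρ) w)).comp (μ G i j).hom.toLinearMap
      = rnorm ((hRep (J G (i + j)) (M ⊗ N)).ρ)
          ((TensorProduct.map f.1 w).comp (μ G i j).hom.toLinearMap) := by
  have h1 : rnorm ((hRep (J G j) N).ρ) w = ∑ h : G, ((hRep (J G j) N).ρ h) w := by
    exact LinearMap.sum_apply _ _ _
  have h2 : rnorm ((hRep (J G (i + j)) (M ⊗ N)).ρ) ((TensorProduct.map f.1 w).comp (μ G i j).hom.toLinearMap)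
      = ∑ h : G, ((hRep (J G (i + j)) (M ⊗ N)).ρ h)
          ((TensorProduct.map f.1 w).comp (μ G i j).hom.toLinearMap) := by
    exact LinearMap.sum_apply _ _ _
  rw [h2]
  have aux : ∀ (P Q M' N' R : Type) [AddCommGroup P] [AddCommGroup Q] [AddCommGroup M']
      [AddCommGroup N'] [AddCommGroup R] [Module ℤ P] [Module ℤ Q] [Module ℤ M'] [Module ℤ N']
      [Module ℤ R] (f' : P →ₗ[ℤ] M') (F : G → Q →ₗ[ℤ] N') (m : R →ₗ[ℤ] P ⊗[ℤ] Q),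
      TensorProduct.map f' (∑ h : G, F h) ∘ₗ m = ∑ h : G, TensorProduct.map f' (F h) ∘ₗ m := by
    intro P Q M' N' R _ _ _ _ _ _ _ _ _ _ f' F m
    exact map_sum (AddMonoidHom.mk' (fun w' : Q →ₗ[ℤ] N' => TensorProduct.map f' w' ∘ₗ m)
      (by intro x y; rw [TensorProduct.map_add_right, LinearMap.add_comp])) _ _
  refine (congrArg (fun v : (J G j).V →ₗ[ℤ] N.V => (TensorProduct.map f.1 v).comp
    (μ G i j).hom.toLinearMap) h1).trans ?_
  refine (aux _ _ _ _ _ f.1 (fun h => ((hRep (J G j) N).ρ h) w) (μ G i j).hom.toLinearMap).trans ?_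
  refine Finset.sum_congr rfl fun h _ => ?_
  have hfinv : M.ρ h ∘ₗ f.1 ∘ₗ (J G i).ρ h⁻¹ = f.1 := f.2 h
  refine Eq.trans ?_ (conj_term f.1 w h)
  exact congrArg (fun x => (TensorProduct.map x (N.ρ h ∘ₗ w ∘ₗ (J G j).ρ h⁻¹)).comp
    (μ G i j).hom.toLinearMap) hfinv.symm

lemma cup_welldef {i j : ℤ} {M N : Rep ℤ G}
    (a₁ : ((hRep (J G i) M).ρ.invariants)) (b₁ : ((hRep (J G j) N).ρ.invariants))
    (a₂ : ((hRep (J G i) M).ρ.invariants)) (b₂ : ((hRep (J G j) N).ρ.invariants))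
    (ha : a₁ - a₂ ∈ rnormIm ((hRep (J G i) M).ρ))
    (hb : b₁ - b₂ ∈ rnormIm ((hRep (J G j) N).ρ)) :
    tate0mk (ρ := (hRep (J G (i + j)) (M ⊗ N)).ρ)
        ((TensorProduct.map a₁.1 b₁.1).comp ((μ G i j).hom.toLinearMap)) (cup_invariance a₁ b₁)
      = tate0mk (ρ := (hRep (J G (i + j)) (M ⊗ N)).ρ)
        ((TensorProduct.map a₂.1 b₂.1).comp ((μ G i j).hom.toLinearMap)) (cup_invariance a₂ b₂) := by
  obtain ⟨u, hu⟩ := ha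
  obtain ⟨w, hw⟩ := hb
  have hu' : rnorm ((hRep (J G i) M).ρ) u = a₁.1 - a₂.1 := congrArg Subtype.val hu
  have hw' : rnorm ((hRep (J G j) N).ρ) w = b₁.1 - b₂.1 := congrArg Subtype.val hw
  have step1 : tate0mk (ρ := (hRep (J G (i + j)) (M ⊗ N)).ρ)
        ((TensorProduct.map a₁.1 b₁.1).comp ((μ G i j).hom.toLinearMap))
        (cup_invariance a₁ b₁)
      = tate0mk (ρ := (hRep (J G (i + j)) (M ⊗ N)).ρ)
        ((TensorProduct.map a₂.1 b₁.1).comp ((μ G i j).hom.toLinearMap)) (cup_invariance a₂ b₁) := by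
    refine (Submodule.Quotient.eq _).mpr ?_
    refine ⟨(TensorProduct.map u b₁.1).comp ((μ G i j).hom.toLinearMap), ?_⟩
    apply Subtype.ext
    have key := cup_norm_left u b₁
    refine key.symm.trans ?_
    refine (congrArg (fun v : (J G i).V →ₗ[ℤ] M.V => (TensorProduct.map v b₁.1).comp
      (μ G i j).hom.toLinearMap) hu').trans ?_
    have aux : ∀ (P Q M' N' R : Type) [AddCommGroup P] [AddCommGroup Q] [AddCommGroup M']
        [AddCommGroup N'] [AddCommGroup R] [Module ℤ P] [Module ℤ Q] [Module ℤ M'] [Module ℤ N']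
        [Module ℤ R] (x y : P →ₗ[ℤ] M') (g' : Q →ₗ[ℤ] N') (m : R →ₗ[ℤ] P ⊗[ℤ] Q),
        TensorProduct.map (x - y) g' ∘ₗ m
          = TensorProduct.map x g' ∘ₗ m - TensorProduct.map y g' ∘ₗ m := by
      intro P Q M' N' R _ _ _ _ _ _ _ _ _ _ x y g' m
      exact map_sub (AddMonoidHom.mk' (fun u' : P →ₗ[ℤ] M' => TensorProduct.map u' g' ∘ₗ m)
        (by intro x y; rw [TensorProduct.map_add_left, LinearMap.add_comp])) _ _
    exact aux _ _ _ _ _ a₁.1 a₂.1 b₁.1 (μ G i j).hom.toLinearMap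
  have step2 : tate0mk (ρ := (hRep (J G (i + j)) (M ⊗ N)).ρ)
        ((TensorProduct.map a₂.1 b₁.1).comp ((μ G i j).hom.toLinearMap))
        (cup_invariance a₂ b₁)
      = tate0mk (ρ := (hRep (J G (i + j)) (M ⊗ N)).ρ)
        ((TensorProduct.map a₂.1 b₂.1).comp ((μ G i j).hom.toLinearMap)) (cup_invariance a₂ b₂) := by
    refine (Submodule.Quotient.eq _).mpr ?_
    refine ⟨(TensorProduct.map a₂.1 w).comp ((μ G i j).hom.toLinearMap), ?_⟩
    apply Subtype.ext
    have key := cup_norm_right a₂ w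
    refine key.symm.trans ?_
    refine (congrArg (fun v : (J G j).V →ₗ[ℤ] N.V => (TensorProduct.map a₂.1 v).comp
      (μ G i j).hom.toLinearMap) hw').trans ?_
    have aux : ∀ (P Q M' N' R : Type) [AddCommGroup P] [AddCommGroup Q] [AddCommGroup M']
        [AddCommGroup N'] [AddCommGroup R] [Module ℤ P] [Module ℤ Q] [Module ℤ M'] [Module ℤ N']
        [Module ℤ R] (f' : P →ₗ[ℤ] M') (x y : Q →ₗ[ℤ] N') (m : R →ₗ[ℤ] P ⊗[ℤ] Q),
        TensorProduct.map f' (x - y) ∘ₗ m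
          = TensorProduct.map f' x ∘ₗ m - TensorProduct.map f' y ∘ₗ m := by
      intro P Q M' N' R _ _ _ _ _ _ _ _ _ _ f' x y m
      exact map_sub (AddMonoidHom.mk' (fun w' : Q →ₗ[ℤ] N' => TensorProduct.map f' w' ∘ₗ m)
        (by intro x y; rw [TensorProduct.map_add_right, LinearMap.add_comp])) _ _
    exact aux _ _ _ _ _ a₂.1 b₁.1 b₂.1 (μ G i j).hom.toLinearMap
  exact step1.trans step2

/-- The cup product `Ĥ^i(G, M) × Ĥ^j(G, N) → Ĥ^{i+j}(G, M ⊗ N)` on Tate cohomology,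
induced by the comparison maps `μ`. -/
noncomputable def cup {i j : ℤ} {M N : Rep ℤ G} (z₁ : tate i M) (z₂ : tate j N) :
    tate (i + j) (M ⊗ N) :=
  Quotient.liftOn₂ z₁ z₂
    (fun f g => tate0mk ((TensorProduct.map f.1 g.1).comp ((μ G i j).hom.toLinearMap)) (cup_invariance f g))
    (fun a₁ b₁ a₂ b₂ ha hb => cup_welldef a₁ b₁ a₂ b₂
      ((Submodule.quotientRel_def _).mp ha) ((Submodule.quotientRel_def _).mp hb))

/-! ### Pairings -/

/-- The composition pairing `Hom_ℤ(B, C) ⊗ Hom_ℤ(A, B) ⟶ Hom_ℤ(A, C)`, `f ⊗ φ ↦ f ∘ φ`. -/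
noncomputable def compPair (A B C : Rep ℤ G) : hRep B C ⊗ hRep A B ⟶ hRep A C :=
  MonoidalClosed.curry <|
    (A ◁ (β_ (hRep B C) (hRep A B)).hom) ≫ (α_ A (hRep A B) (hRep B C)).inv
      ≫ (((ihom.ev A).app B) ▷ hRep B C) ≫ (ihom.ev B).app C

/-- The evaluation pairing `Hom_ℤ(X, B) ⊗ X ⟶ B`, `f ⊗ x ↦ f x`. -/
noncomputable def evPair (X B : Rep ℤ G) : hRep X B ⊗ X ⟶ B :=
  (β_ (hRep X B) X).hom ≫ (ihom.ev X).app B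

/-- The cup product `Ĥ^i(G, Hom(X, A)) × Ĥ^j(G, Hom(X', X)) → Ĥ^{i+j}(G, Hom(X', A))`
induced by the composition pairing. -/
noncomputable def ccup {i j : ℤ} {X X' A : Rep ℤ G}
    (z : tate i (hRep X A)) (x : tate j (hRep X' X)) : tate (i + j) (hRep X' A) :=
  tmap (i + j) (compPair X' X A) (cup z x)

/-- `ccup`, with the degree of the target adjusted along an equality of integers. -/
noncomputable def ccupTo {i j m : ℤ} {X X' A : Rep ℤ G}
    (z : tate i (hRep X A)) (x : tate j (hRep X' X)) (h : i + j = m) :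
    tate m (hRep X' A) :=
  tcast h (ccup z x)

/-- The class of the identity in `Ĥ⁰(G, Hom_ℤ(X, X))`. -/
noncomputable def idCls (X : Rep ℤ G) : tate 0 (hRep X X) :=
  mkCls (MonoidalClosed.curry (ρ_ X).hom)

/-! ### Encoding pairs and related notions -/

/-- `(X, X')` is an *`r`-encoding pair* if for some `i ∈ ℤ` there is a natural isomorphism
of functors `Ĥ^i(G, Hom_ℤ(X, -)) ≅ Ĥ^{i+r}(G, Hom_ℤ(X', -))` on `Rep ℤ G`. -/
def IsEncodingPair {G : Type} [Group G] [Fintype G] (r : ℤ) (X X' : Rep ℤ G) : Prop :=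
  ∃ (i : ℤ) (e : ∀ A : Rep ℤ G, tate i (hRep X A) ≃+ tate (i + r) (hRep X' A)),
    ∀ {A B : Rep ℤ G} (φ : A ⟶ B) (z : tate i (hRep X A)),
      e B (tmap i ((Rep.ihom X).map φ) z) = tmap (i + r) ((Rep.ihom X').map φ) (e A z)

/-- `x ∈ Ĥ^r(G, Hom_ℤ(X', X))` is an *encoding element* for the pair `(X, X')` if it has a
*decoding element* `x' ∈ Ĥ^{-r}(G, Hom_ℤ(X, X'))` with `x' ∪ x = [id_{X'}]` and
`x ∪ x' = [id_X]`. -/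
def IsEncodingElement {G : Type} [Group G] [Fintype G] {r : ℤ} (X X' : Rep ℤ G)
    (x : tate r (hRep X' X)) : Prop :=
  ∃ x' : tate (-r) (hRep X X'),
    ccupTo x' x (by ring) = idCls X' ∧ ccupTo x x' (by ring) = idCls X

/-- The induced `G`-module `ℤ[G] ⊗_ℤ A ≅ (G →₀ A)`, with `G` acting by left translation. -/
noncomputable def indRep (G : Type) [Group G] (A : Type) [AddCommGroup A] [Module ℤ A] :
    Rep ℤ G :=
  Rep.of (G := G) (X := G →₀ A)
    { toFun := fun g => Finsupp.lmapDomain A ℤ (fun h => g * h)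
      map_one' := by
        ext x h
        simp [Finsupp.lmapDomain_apply, Finsupp.mapDomain_id, one_mul]
      map_mul' := fun g g' => by
        ext x h
        simp [Finsupp.lmapDomain_apply, Module.End.mul_apply, Finsupp.mapDomain_single,
          mul_assoc] }

/-- A `G`-module is *induced* if it is isomorphic to `ℤ[G] ⊗_ℤ A` for some abelian group `A`. -/
def IsInduced {G : Type} [Group G] (M : Rep ℤ G) : Prop :=
  ∃ (A : Type) (_ : AddCommGroup A) (_ : Module ℤ A), Nonempty (M ≅ indRep G A)

/-- A class `φ ∈ Ĥ⁰(G, Hom_ℤ(X, X))` is a unit for the (composition) cup product. -/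
def IsUnitCls {G : Type} [Group G] [Fintype G] {X : Rep ℤ G}
    (φ : tate 0 (hRep X X)) : Prop :=
  ∃ ψ : tate 0 (hRep X X),
    ccupTo φ ψ (by ring) = idCls X ∧ ccupTo ψ φ (by ring) = idCls X


/-- The natural map `Hom_ℤ(X, A) ⊗ I_G ⟶ Hom_ℤ(X, A ⊗ I_G)`, `f ⊗ z ↦ (x ↦ f x ⊗ z)`. -/
noncomputable def pr0 (X A : Rep ℤ G) : hRep X A ⊗ IGrep G ⟶ hRep X (A ⊗ IGrep G) :=
  MonoidalClosed.curry ((α_ X (hRep X A) (IGrep G)).inv ≫ ((ihom.ev X).app A ▷ IGrep G))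

/-- The natural evaluation map `Hom_ℤ(X, Hom_ℤ(I_G, A)) ⊗ I_G ⟶ Hom_ℤ(X, A)`,
`f ⊗ z ↦ (x ↦ f x z)`. -/
noncomputable def pr1 (X A : Rep ℤ G) :
    hRep X (hRep (IGrep G) A) ⊗ IGrep G ⟶ hRep X A :=
  MonoidalClosed.curry ((α_ X (hRep X (hRep (IGrep G) A)) (IGrep G)).inv
    ≫ ((ihom.ev X).app (hRep (IGrep G) A) ▷ IGrep G) ≫ evPair (IGrep G) A)

/-- The natural evaluation map `Hom_ℤ(X', X) ⊗ (X' ⊗ A) ⟶ X ⊗ A`. -/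
noncomputable def tPair (X' X A : Rep ℤ G) : hRep X' X ⊗ (X' ⊗ A) ⟶ X ⊗ A :=
  (α_ (hRep X' X) X' A).inv ≫ (evPair X' X ▷ A)

/-- A functor `Rep ℤ G ⥤ Rep ℤ G` sends `ℤ`-split short exact sequences of `G`-modules to
short exact sequences of `G`-modules. -/
def PreservesZSplitSES {G : Type} [Group G] (F : Rep.{0} ℤ G ⥤ Rep.{0} ℤ G) : Prop :=
  ∀ (A B C : Rep ℤ G) (f : A ⟶ B) (g : B ⟶ C),
    Function.Injective f.hom → Function.Surjective g.hom → Function.Exact f.hom g.hom →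
    (∃ s : C.V →+ B.V, ∀ x, g.hom (s x) = x) →
    Function.Injective (F.map f).hom ∧ Function.Surjective (F.map g).hom ∧
      Function.Exact (F.map f).hom (F.map g).hom

/-- A *shiftable functor*: it sends `ℤ`-split short exact sequences of `G`-modules to short
exact sequences, and sends induced modules to induced modules. -/
def Shiftable {G : Type} [Group G] (F : Rep ℤ G ⥤ Rep ℤ G) : Prop :=
  PreservesZSplitSES F ∧ ∀ M : Rep ℤ G, IsInduced M → IsInduced (F.obj M)

/-! ### The proof of the theorem -/

lemma sMap_eq {n : ℤ} (m : ℕ) (h : n = (m : ℤ)) :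
    sMap (G := G) n = eqToHom (by subst h; rfl) := by
  subst h; rfl

lemma tMap_eq {n : ℤ} (m : ℕ) (h : n = -(m : ℤ)) :
    tMap (G := G) n = eqToHom (by subst h; cases m <;> rfl) := by
  subst h; cases m <;> rfl

lemma eqToHom_wr {A B C : Rep.{0} ℤ G} (h : A = B) :
    eqToHom h ▷ C = eqToHom (congrArg (fun Y => Y ⊗ C) h) := by
  subst h; simp

lemma coherence_aux {P Q R S U I : Rep.{0} ℤ G} (a : P = R) (b : R = S ⊗ I) (c : S = Q)
    (e : Q ⊗ I = U) (d : P = U) :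
    eqToHom a ≫ eqToHom b ≫ ((eqToHom c ≫ (λ_ Q).inv) ▷ I) ≫ (α_ (𝟙_ (Rep.{0} ℤ G)) Q I).hom
      ≫ (𝟙_ (Rep.{0} ℤ G) ◁ eqToHom e) = eqToHom d ≫ (λ_ U).inv := by
  subst e c b a
  simp

lemma coherence_aux' {P Q R S I : Rep.{0} ℤ G} (a : P = R) (b : R = S ⊗ I) (c : S = Q)
    (d : P = Q ⊗ I) :
    eqToHom a ≫ eqToHom b ≫ ((eqToHom c ≫ (λ_ Q).inv) ▷ I) ≫ (α_ (𝟙_ (Rep.{0} ℤ G)) Q I).hom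
      = eqToHom d ≫ (λ_ (Q ⊗ I)).inv := by
  subst c b a
  simp

lemma μpos_zero (m : ℕ) : μpos (G := G) 0 m =
    eqToHom (congrArg (J G) (zero_add (m : ℤ))) ≫ (λ_ (J G (m : ℤ))).inv := by
  induction m with
  | zero =>
    show _ ≫ (ρ_ (𝟙_ (Rep.{0} ℤ G))).inv = _ ≫ (λ_ (𝟙_ (Rep.{0} ℤ G))).inv
    rw [unitors_inv_equal]
  | succ m ih =>
    rw [μpos, ih, sMap_eq m (zero_add _)]
    exact coherence_aux' (I := IGrep G) (S := J G (0 + (m : ℤ)))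
      (Q := J G (m : ℤ)) (R := J G (0 + (m : ℤ) + 1)) _ _ _ _

lemma μneg_zero (m : ℕ) : μneg (G := G) 0 m =
    eqToHom (congrArg (J G) (zero_sub (m : ℤ))) ≫ (λ_ (J G (-(m : ℤ)))).inv := by
  induction m with
  | zero =>
    show _ ≫ (ρ_ (𝟙_ (Rep.{0} ℤ G))).inv = _ ≫ (λ_ (𝟙_ (Rep.{0} ℤ G))).inv
    rw [unitors_inv_equal]
  | succ m ih =>
    rw [μneg, ih, tMap_eq m (zero_sub _)]
    exact coherence_aux (I := DIG G) (S := J G (0 - (m : ℤ)))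
      (Q := J G (-(m : ℤ))) (U := J G (-((m + 1 : ℕ) : ℤ))) (R := J G (0 - (m : ℤ) - 1))
      _ _ _ _ _

lemma μ_zero (r : ℤ) : μ G 0 r =
    eqToHom (congrArg (J G) (zero_add r)) ≫ (λ_ (J G r)).inv := by
  cases r with
  | ofNat m => exact μpos_zero m
  | negSucc m =>
    show eqToHom _ ≫ μneg 0 (m+1) = _
    rw [μneg_zero]
    exact eqToHom_trans_assoc _ _ _

lemma curry_apply' {A B C : Rep.{0} ℤ G} (f : A ⊗ B ⟶ C) (b : B.V) (a : A.V) :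
    (show A.V →ₗ[ℤ] C.V from (MonoidalClosed.curry f).hom b) a = f.hom (a ⊗ₜ[ℤ] b) := by
  have h : MonoidalClosed.curry f = Rep.tensorHomEquiv A B C f := by
    rw [← Rep.homEquiv_def]; rfl
  rw [h]
  rfl

lemma curry_rid_apply (X : Rep.{0} ℤ G) (v : X.V) :
    (show X.V →ₗ[ℤ] X.V from (MonoidalClosed.curry (ρ_ X).hom).hom (1 : ℤ)) v = v := by
  refine (curry_apply' (ρ_ X).hom (1 : ℤ) v).trans ?_
  rw [Rep.hom_hom_rightUnitor]
  exact (TensorProduct.rid_tmul (R := ℤ) v (1 : ℤ)).trans (@one_smul ℤ X.V _ (Module.toDistribMulAction (self := X.hV2)).toMulAction v)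

lemma compPair_apply {A B C : Rep.{0} ℤ G} (f : B.V →ₗ[ℤ] C.V) (φ : A.V →ₗ[ℤ] B.V) (a : A.V) :
    (show A.V →ₗ[ℤ] C.V from (compPair A B C).hom
      ((show (hRep B C).V from f) ⊗ₜ[ℤ] (show (hRep A B).V from φ))) a = f (φ a) := by
  refine (curry_apply' _ _ _).trans ?_
  rfl

lemma exists_hom_of_cls {X A : Rep.{0} ℤ G} (z : tate 0 (hRep X A)) :
    ∃ φ : X ⟶ A, z = tmap 0 ((Rep.ihom X).map φ) (idCls X) := by
  obtain ⟨⟨f, hf⟩, rfl⟩ := Submodule.Quotient.mk_surjective _ z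
  change ℤ →ₗ[ℤ] (X.V →ₗ[ℤ] A.V) at f
  have hf' : ∀ g : G, A.ρ g ∘ₗ f 1 ∘ₗ X.ρ g⁻¹ = f 1 := fun g =>
    LinearMap.congr_fun (hf g) (1 : ℤ)
  refine ⟨Rep.ofHom ⟨f 1, fun g => ?_⟩, ?_⟩
  · apply LinearMap.ext
    intro v
    have := LinearMap.congr_fun (hf' g) (X.ρ g v)
    refine this.symm.trans ?_
    exact congrArg (fun w => A.ρ g (f 1 w)) (X.ρ.inv_self_apply g v)
  · refine congrArg Submodule.Quotient.mk (Subtype.ext ?_)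
    refine LinearMap.ext_ring ?_
    apply LinearMap.ext
    intro v
    exact (congrArg (f 1) (curry_rid_apply X v)).symm

lemma tmap_id {n : ℤ} {X A : Rep.{0} ℤ G} (z : tate n (hRep X A)) :
    tmap n ((Rep.ihom X).map (𝟙 A)) z = z := by
  obtain ⟨⟨f, hf⟩, rfl⟩ := Submodule.Quotient.mk_surjective _ z
  rfl

lemma tcast_mk {i j : ℤ} (h : i = j) {M : Rep.{0} ℤ G} (f : (J G j).V →ₗ[ℤ] M.V)
    (f' : (J G i).V →ₗ[ℤ] M.V)
    (hff : f' = f ∘ₗ (eqToHom (congrArg (J G) h)).hom.toLinearMap)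
    (hf : f ∈ (hRep (J G j) M).ρ.invariants) (hf' : f' ∈ (hRep (J G i) M).ρ.invariants) :
    tcast h (tate0mk (ρ := (hRep (J G i) M).ρ) f' hf' : tate i M)
      = tate0mk (ρ := (hRep (J G j) M).ρ) f hf := by
  subst h
  have : f' = f := hff
  subst this
  rfl

lemma ccup_id {r : ℤ} {X X' A : Rep.{0} ℤ G} (φ : X ⟶ A) (x : tate r (hRep X' X)) :
    ccupTo (tmap 0 ((Rep.ihom X).map φ) (idCls X)) x (zero_add r)
      = tmap r ((Rep.ihom X').map φ) x := by
  obtain ⟨⟨f, hf⟩, rfl⟩ := Submodule.Quotient.mk_surjective _ x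
  refine tcast_mk (zero_add r) _ _ ?_ _ _
  show ((compPair X' X A).hom.toLinearMap) ∘ₗ ((TensorProduct.map _ f).comp ((μ G 0 r).hom.toLinearMap)) = _
  rw [μ_zero]
  apply LinearMap.ext
  intro v
  generalize hw : (eqToHom (congrArg (J G) (zero_add r))).hom v = w
  change (J G r).V →ₗ[ℤ] (X'.V →ₗ[ℤ] X.V) at f
  apply LinearMap.ext
  intro a
  have h1 : (eqToHom (congrArg (J G) (zero_add r)) ≫ (λ_ (J G r)).inv).hom v
      = (1 : ℤ) ⊗ₜ[ℤ] w := by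
    rw [← hw]
    show (λ_ (J G r)).inv.hom _ = _
    rw [Rep.hom_inv_leftUnitor]
    rfl
  have h2 := compPair_apply (φ.hom.toLinearMap ∘ₗ
    (show X.V →ₗ[ℤ] X.V from (MonoidalClosed.curry (ρ_ X).hom).hom (1 : ℤ))) (f w) a
  have h3 : φ.hom.toLinearMap ((show X.V →ₗ[ℤ] X.V from
      (MonoidalClosed.curry (ρ_ X).hom).hom (1 : ℤ)) (f w a)) = φ.hom.toLinearMap (f w a) :=
    congrArg φ.hom.toLinearMap (curry_rid_apply X (f w a))
  subst hw
  refine Eq.trans ?_ (h2.trans h3)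
  refine congrArg (fun t => (show X'.V →ₗ[ℤ] A.V from (compPair X' X A).hom t) a) ?_
  exact congrArg (TensorProduct.map _ f) h1

end Enc

open CategoryTheory MonoidalCategory Enc

theorem statement3 (G : Type) [Group G] [Fintype G] (X X' : Rep ℤ G) (r : ℤ)
    (Φ : ∀ A : Rep ℤ G, tate 0 (hRep X A) →+ tate r (hRep X' A))
    (hΦ : ∀ {A B : Rep ℤ G} (φ : A ⟶ B) (z : tate 0 (hRep X A)),
        Φ B (tmap 0 ((Rep.ihom X).map φ) z) = tmap r ((Rep.ihom X').map φ) (Φ A z)) :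
    ∃! x : tate r (hRep X' X), ∀ (A : Rep ℤ G) (z : tate 0 (hRep X A)),
      Φ A z = ccupTo z x (zero_add r) := by
  refine ⟨Φ X (idCls X), fun A z => ?_, fun y hy => ?_⟩
  · obtain ⟨φ, rfl⟩ := exists_hom_of_cls z
    rw [hΦ φ (idCls X), ccup_id]
  · rw [hy X (idCls X)]
    have h := ccup_id (𝟙 X) y
    rw [tmap_id, tmap_id] at h
    exact h.symm
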